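/- Completeness of bidirectional typing with cumulativity: if Γ ⊢ t : T is derivable in the cumulative undirected system, then there exists a term T' such that Γ ⊢ t ▹ T' is derivable in the cumulative bidirectional system and T' ≼ T. -/

import Mathlib

/-! Formalization of CCω (terms, reduction, conversion, undirected and
bidirectional typing, cumulativity) using de Bruijn indices, following
Lennon-Bertrand, "Complete Bidirectional Typing for the Calculus of
Inductive Constructions". -/

namespace CComega

/-- Terms of CCω: `t ::= x | □_i | Πx:t.t | λx:t.t | t t`,
with variables as de Bruijn indices. -/
inductive Tm : Type
  | var : ℕ → Tm
  | sort : ℕ → Tm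
  | pi : Tm → Tm → Tm
  | lam : Tm → Tm → Tm
  | app : Tm → Tm → Tm
deriving DecidableEq

/-- `lift n k t` shifts by `n` the de Bruijn indices of `t` that are ≥ `k`. -/
def lift (n k : ℕ) : Tm → Tm
  | .var i => if i < k then .var i else .var (i + n)
  | .sort i => .sort i
  | .pi A B => .pi (lift n k A) (lift n (k + 1) B)
  | .lam A t => .lam (lift n k A) (lift n (k + 1) t)
  | .app t u => .app (lift n k t) (lift n k u)

/-- `subst u k t` is the capture-avoiding substitution `t[u/k]` of `u`
for de Bruijn index `k` in `t`. -/
def subst (u : Tm) (k : ℕ) : Tm → Tm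
  | .var i => if i < k then .var i else if i = k then lift k 0 u else .var (i - 1)
  | .sort i => .sort i
  | .pi A B => .pi (subst u k A) (subst u (k + 1) B)
  | .lam A t => .lam (subst u k A) (subst u (k + 1) t)
  | .app t v => .app (subst u k t) (subst u k v)

/-- One-step reduction `t → t'`: the least congruence such that
`(λx:A.t) u → t[u/x]`. -/
inductive Red : Tm → Tm → Prop
  | beta (A t u : Tm) : Red (.app (.lam A t) u) (subst u 0 t)
  | piDom {A A'} (B : Tm) : Red A A' → Red (.pi A B) (.pi A' B)
  | piCod (A : Tm) {B B'} : Red B B' → Red (.pi A B) (.pi A B')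
  | lamDom {A A'} (t : Tm) : Red A A' → Red (.lam A t) (.lam A' t)
  | lamBody (A : Tm) {t t'} : Red t t' → Red (.lam A t) (.lam A t')
  | appFun {t t'} (u : Tm) : Red t t' → Red (.app t u) (.app t' u)
  | appArg (t : Tm) {u u'} : Red u u' → Red (.app t u) (.app t u')

/-- Multi-step reduction `t ↠ t'`: reflexive-transitive closure of `→`. -/
def Reds : Tm → Tm → Prop := Relation.ReflTransGen Red

/-- Conversion `t ≡ u`: symmetric, reflexive, transitive closure of `→`. -/
def Conv : Tm → Tm → Prop := Relation.EqvGen Red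

/-- Contexts are lists of (de Bruijn) declarations, most recent first. -/
abbrev Ctx := List Tm

mutual
/-- Context well-formedness `⊢ Γ`. -/
inductive WfCtx : Ctx → Prop
  | nil : WfCtx []
  | cons {Γ A i} : WfCtx Γ → Typed Γ A (.sort i) → WfCtx (A :: Γ)

/-- Undirected typing `Γ ⊢ t : T`. -/
inductive Typed : Ctx → Tm → Tm → Prop
  | sort {Γ i} : WfCtx Γ → Typed Γ (.sort i) (.sort (i + 1))
  | var {Γ n A} : WfCtx Γ → Γ[n]? = some A → Typed Γ (.var n) (lift (n + 1) 0 A)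
  | pi {Γ A B i j} : Typed Γ A (.sort i) → Typed (A :: Γ) B (.sort j) →
      Typed Γ (.pi A B) (.sort (max i j))
  | lam {Γ A B t i} : Typed Γ (.pi A B) (.sort i) → Typed (A :: Γ) t B →
      Typed Γ (.lam A t) (.pi A B)
  | app {Γ t u A B} : Typed Γ t (.pi A B) → Typed Γ u A →
      Typed Γ (.app t u) (subst u 0 B)
  | conv {Γ t A B i} : Typed Γ t A → Typed Γ B (.sort i) → Conv A B →
      Typed Γ t B
end

mutual
/-- Bidirectional inference `Γ ⊢ t ▹ T`. -/
inductive Infer : Ctx → Tm → Tm → Prop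
  | sort {Γ i} : Infer Γ (.sort i) (.sort (i + 1))
  | var {Γ n A} : Γ[n]? = some A → Infer Γ (.var n) (lift (n + 1) 0 A)
  | pi {Γ A B i j} : InferSort Γ A (.sort i) → InferSort (A :: Γ) B (.sort j) →
      Infer Γ (.pi A B) (.sort (max i j))
  | lam {Γ A t B i} : InferSort Γ A (.sort i) → Infer (A :: Γ) t B →
      Infer Γ (.lam A t) (.pi A B)
  | app {Γ t u A B} : InferPi Γ t (.pi A B) → Check Γ u A →
      Infer Γ (.app t u) (subst u 0 B)

/-- Bidirectional checking `Γ ⊢ t ◃ T`. -/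
inductive Check : Ctx → Tm → Tm → Prop
  | check {Γ t T T'} : Infer Γ t T' → Conv T' T → Check Γ t T

/-- Constrained inference `Γ ⊢ t ▹_□ T` (the output is a universe). -/
inductive InferSort : Ctx → Tm → Tm → Prop
  | inferSort {Γ t T i} : Infer Γ t T → Reds T (.sort i) → InferSort Γ t (.sort i)

/-- Constrained inference `Γ ⊢ t ▹_Π T` (the output is a product type). -/
inductive InferPi : Ctx → Tm → Tm → Prop
  | inferPi {Γ t T A B} : Infer Γ t T → Reds T (.pi A B) → InferPi Γ t (.pi A B)
end

/-- Weak-head reduction `t ⇝ t'`: reduction only at the head. -/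
inductive WhRed : Tm → Tm → Prop
  | beta (A t u : Tm) : WhRed (.app (.lam A t) u) (subst u 0 t)
  | appFun {t t'} (u : Tm) : WhRed t t' → WhRed (.app t u) (.app t' u)

/-- Multi-step weak-head reduction `t ⇝* t'`. -/
def WhReds : Tm → Tm → Prop := Relation.ReflTransGen WhRed

mutual
/-- Weak-head bidirectional inference: as `Infer`, but constrained inference
uses weak-head reduction. -/
inductive InferW : Ctx → Tm → Tm → Prop
  | sort {Γ i} : InferW Γ (.sort i) (.sort (i + 1))
  | var {Γ n A} : Γ[n]? = some A → InferW Γ (.var n) (lift (n + 1) 0 A)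
  | pi {Γ A B i j} : InferSortW Γ A (.sort i) → InferSortW (A :: Γ) B (.sort j) →
      InferW Γ (.pi A B) (.sort (max i j))
  | lam {Γ A t B i} : InferSortW Γ A (.sort i) → InferW (A :: Γ) t B →
      InferW Γ (.lam A t) (.pi A B)
  | app {Γ t u A B} : InferPiW Γ t (.pi A B) → CheckW Γ u A →
      InferW Γ (.app t u) (subst u 0 B)

/-- Weak-head bidirectional checking. -/
inductive CheckW : Ctx → Tm → Tm → Prop
  | check {Γ t T T'} : InferW Γ t T' → Conv T' T → CheckW Γ t T

/-- Weak-head constrained inference `Γ ⊢ t ▹_□ T`. -/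
inductive InferSortW : Ctx → Tm → Tm → Prop
  | inferSort {Γ t T i} : InferW Γ t T → WhReds T (.sort i) →
      InferSortW Γ t (.sort i)

/-- Weak-head constrained inference `Γ ⊢ t ▹_Π T`. -/
inductive InferPiW : Ctx → Tm → Tm → Prop
  | inferPi {Γ t T A B} : InferW Γ t T → WhReds T (.pi A B) →
      InferPiW Γ t (.pi A B)
end

/-- Cumulativity `t ≼ u`: the least transitive relation containing conversion
such that `□_i ≼ □_j` whenever `i ≤ j` and `Πx:A.B ≼ Πx:A'.B'` whenever
`A ≡ A'` and `B ≼ B'`. -/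
inductive Cum : Tm → Tm → Prop
  | ofConv {t u} : Conv t u → Cum t u
  | sort {i j : ℕ} : i ≤ j → Cum (.sort i) (.sort j)
  | pi {A A' B B'} : Conv A A' → Cum B B' → Cum (.pi A B) (.pi A' B')
  | trans {t u v} : Cum t u → Cum u v → Cum t v

mutual
/-- Context well-formedness for the cumulative undirected system. -/
inductive WfCtxC : Ctx → Prop
  | nil : WfCtxC []
  | cons {Γ A i} : WfCtxC Γ → TypedC Γ A (.sort i) → WfCtxC (A :: Γ)

/-- Cumulative undirected typing `Γ ⊢ t : T`: as `Typed`, with the conversion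
rule replaced by cumulativity. -/
inductive TypedC : Ctx → Tm → Tm → Prop
  | sort {Γ i} : WfCtxC Γ → TypedC Γ (.sort i) (.sort (i + 1))
  | var {Γ n A} : WfCtxC Γ → Γ[n]? = some A → TypedC Γ (.var n) (lift (n + 1) 0 A)
  | pi {Γ A B i j} : TypedC Γ A (.sort i) → TypedC (A :: Γ) B (.sort j) →
      TypedC Γ (.pi A B) (.sort (max i j))
  | lam {Γ A B t i} : TypedC Γ (.pi A B) (.sort i) → TypedC (A :: Γ) t B →
      TypedC Γ (.lam A t) (.pi A B)
  | app {Γ t u A B} : TypedC Γ t (.pi A B) → TypedC Γ u A →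
      TypedC Γ (.app t u) (subst u 0 B)
  | cumul {Γ t A B i} : TypedC Γ t A → TypedC Γ B (.sort i) → Cum A B →
      TypedC Γ t B
end

mutual
/-- Cumulative bidirectional inference `Γ ⊢ t ▹ T`. -/
inductive InferC : Ctx → Tm → Tm → Prop
  | sort {Γ i} : InferC Γ (.sort i) (.sort (i + 1))
  | var {Γ n A} : Γ[n]? = some A → InferC Γ (.var n) (lift (n + 1) 0 A)
  | pi {Γ A B i j} : InferSortC Γ A (.sort i) → InferSortC (A :: Γ) B (.sort j) →
      InferC Γ (.pi A B) (.sort (max i j))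
  | lam {Γ A t B i} : InferSortC Γ A (.sort i) → InferC (A :: Γ) t B →
      InferC Γ (.lam A t) (.pi A B)
  | app {Γ t u A B} : InferPiC Γ t (.pi A B) → CheckC Γ u A →
      InferC Γ (.app t u) (subst u 0 B)

/-- Cumulative bidirectional checking `Γ ⊢ t ◃ T`, using cumulativity. -/
inductive CheckC : Ctx → Tm → Tm → Prop
  | check {Γ t T T'} : InferC Γ t T' → Cum T' T → CheckC Γ t T

/-- Cumulative constrained inference `Γ ⊢ t ▹_□ T` (unchanged: uses reduction). -/
inductive InferSortC : Ctx → Tm → Tm → Prop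
  | inferSort {Γ t T i} : InferC Γ t T → Reds T (.sort i) → InferSortC Γ t (.sort i)

/-- Cumulative constrained inference `Γ ⊢ t ▹_Π T` (unchanged: uses reduction). -/
inductive InferPiC : Ctx → Tm → Tm → Prop
  | inferPi {Γ t T A B} : InferC Γ t T → Reds T (.pi A B) → InferPiC Γ t (.pi A B)
end

section Substitution

theorem lift_lift_comm (n m : ℕ) (t : Tm) : ∀ {j k : ℕ}, j ≤ k →
    lift n (k + m) (lift m j t) = lift m j (lift n k t) := by
  induction t with
  | var i =>
    intro j k h
    simp only [lift]
    split_ifs <;> simp only [lift] <;> split_ifs <;> first | omega | (congr 1 <;> omega)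
  | sort i => intros; rfl
  | pi A B ihA ihB | lam A B ihA ihB =>
    intro j k h
    have hB := @ihB (j + 1) (k + 1) (by omega)
    rw [Nat.add_right_comm] at hB
    simp only [lift, ihA h, hB]
  | app t u iht ihu => intro j k h; simp only [lift, iht h, ihu h]

theorem lift_lift_add (n m : ℕ) (t : Tm) : ∀ {j k : ℕ}, j ≤ k → k ≤ j + n →
    lift m k (lift n j t) = lift (n + m) j t := by
  induction t with
  | var i =>
    intro j k h h'
    simp only [lift]
    split_ifs <;> simp only [lift] <;> split_ifs <;> first | omega | (congr 1 <;> omega)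
  | sort i => intros; rfl
  | pi A B ihA ihB | lam A B ihA ihB =>
    intro j k h h'
    simp only [lift, ihA h h', @ihB (j + 1) (k + 1) (by omega) (by omega)]
  | app t u iht ihu => intro j k h h'; simp only [lift, iht h h', ihu h h']

theorem subst_lift_cancel (u : Tm) (n : ℕ) (t : Tm) : ∀ {j k : ℕ}, j ≤ k → k ≤ j + n →
    subst u k (lift (n + 1) j t) = lift n j t := by
  induction t with
  | var i =>
    intro j k h h'
    simp only [lift]
    split_ifs <;> simp only [subst] <;> split_ifs <;> first | omega | congr 1
  | sort i => intros; rfl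
  | pi A B ihA ihB | lam A B ihA ihB =>
    intro j k h h'
    simp only [lift, subst, ihA h h', @ihB (j + 1) (k + 1) (by omega) (by omega)]
  | app t u iht ihu => intro j k h h'; simp only [lift, subst, iht h h', ihu h h']

theorem lift_subst (u : Tm) (n k : ℕ) (t : Tm) : ∀ j : ℕ,
    lift n (k + j) (subst u j t) = subst (lift n k u) j (lift n (k + j + 1) t) := by
  induction t with
  | var i =>
    intro j
    rcases lt_trichotomy i j with h | rfl | h
    · simp [lift, subst, h, show i < k + j by omega, show i < k + j + 1 by omega]
    · simp [lift, subst, lift_lift_comm n i u (Nat.zero_le k), show i < k + i + 1 by omega]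
    · simp only [lift, subst]
      split_ifs <;> simp only [lift, subst] <;> split_ifs <;>
        first | omega | (congr 1 <;> omega)
  | sort i => intros; rfl
  | pi A B ihA ihB | lam A B ihA ihB =>
    intro j
    simp only [lift, subst, ihA j]
    rw [Nat.add_assoc k j 1, ihB (j + 1)]
  | app t u iht ihu => intro j; simp only [lift, subst, iht j, ihu j]

theorem subst_lift (u : Tm) (n : ℕ) (t : Tm) : ∀ {j k : ℕ}, j ≤ k →
    subst u (k + n) (lift n j t) = lift n j (subst u k t) := by
  induction t with
  | var i =>
    intro j k h
    rcases lt_trichotomy i k with h' | rfl | h'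
    · simp only [lift, subst, h', if_true]
      split_ifs <;> simp only [subst] <;> split_ifs <;> first | omega | rfl
    · simp [lift, subst, Nat.not_lt.2 h, lift_lift_add i n u (Nat.zero_le j) (by omega)]
    · simp only [lift, subst]
      split_ifs <;> simp only [lift, subst] <;> split_ifs <;>
        first | omega | (congr 1 <;> omega)
  | sort i => intros; rfl
  | pi A B ihA ihB | lam A B ihA ihB =>
    intro j k h
    have hB := @ihB (j + 1) (k + 1) (by omega)
    rw [Nat.add_right_comm] at hB
    simp only [lift, subst, ihA h, hB]
  | app t u iht ihu => intro j k h; simp only [lift, subst, iht h, ihu h]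

theorem subst_subst (u v : Tm) (k : ℕ) (t : Tm) : ∀ j : ℕ,
    subst u (k + j) (subst v j t) = subst (subst u k v) j (subst u (k + j + 1) t) := by
  induction t with
  | var i =>
    intro j
    rcases lt_trichotomy i j with h | rfl | h
    · simp [subst, h, show i < k + j by omega, show i < k + j + 1 by omega]
    · simp [subst, subst_lift u i v (Nat.zero_le k), show i < k + i + 1 by omega]
    · rcases lt_trichotomy i (k + j + 1) with h' | rfl | h'
      · simp only [subst]
        split_ifs <;> try omega
        simp only [subst]
        split_ifs <;> first | omega | rfl
      · simp only [subst]
        split_ifs <;> try omega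
        simp only [subst]
        split_ifs <;> try omega
        rw [subst_lift_cancel _ _ _ (Nat.zero_le j) (by omega)]
      · simp only [subst]
        split_ifs <;> try omega
        simp only [subst]
        split_ifs <;> first | omega | rfl
  | sort i => intros; rfl
  | pi A B ihA ihB | lam A B ihA ihB =>
    intro j
    simp only [subst, ihA j]
    rw [Nat.add_assoc k j 1, ihB (j + 1)]
  | app t u iht ihu => intro j; simp only [subst, iht j, ihu j]

end Substitution

section Confluence

/-- Parallel reduction. -/
inductive Par : Tm → Tm → Prop
  | var (i : ℕ) : Par (.var i) (.var i)
  | sort (i : ℕ) : Par (.sort i) (.sort i)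
  | pi {A A' B B'} : Par A A' → Par B B' → Par (.pi A B) (.pi A' B')
  | lam {A A' t t'} : Par A A' → Par t t' → Par (.lam A t) (.lam A' t')
  | app {t t' u u'} : Par t t' → Par u u' → Par (.app t u) (.app t' u')
  | beta (A : Tm) {t t' u u'} : Par t t' → Par u u' →
      Par (.app (.lam A t) u) (subst u' 0 t')

theorem Par.refl (t : Tm) : Par t t := by
  induction t <;> constructor <;> assumption

theorem Red.par {t u : Tm} (h : Red t u) : Par t u := by
  induction h with
  | beta A t u => exact .beta A (.refl t) (.refl u)
  | piDom B _ ih => exact .pi ih (.refl B)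
  | piCod A _ ih => exact .pi (.refl A) ih
  | lamDom t _ ih => exact .lam ih (.refl t)
  | lamBody A _ ih => exact .lam (.refl A) ih
  | appFun u _ ih => exact .app ih (.refl u)
  | appArg t _ ih => exact .app (.refl t) ih

theorem Reds.pi {A A' B B' : Tm} (hA : Reds A A') (hB : Reds B B') :
    Reds (.pi A B) (.pi A' B') :=
  (hA.lift (Tm.pi · B) fun _ _ => .piDom B).trans (hB.lift (Tm.pi A') fun _ _ => .piCod A')

theorem Reds.lam {A A' t t' : Tm} (hA : Reds A A') (ht : Reds t t') :
    Reds (.lam A t) (.lam A' t') :=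
  (hA.lift (Tm.lam · t) fun _ _ => .lamDom t).trans (ht.lift (Tm.lam A') fun _ _ => .lamBody A')

theorem Reds.app {t t' u u' : Tm} (ht : Reds t t') (hu : Reds u u') :
    Reds (.app t u) (.app t' u') :=
  (ht.lift (Tm.app · u) fun _ _ => .appFun u).trans (hu.lift (Tm.app t') fun _ _ => .appArg t')

theorem Par.reds {t u : Tm} (h : Par t u) : Reds t u := by
  induction h with
  | var | sort => exact .refl
  | pi _ _ ih₁ ih₂ => exact ih₁.pi ih₂
  | lam _ _ ih₁ ih₂ => exact ih₁.lam ih₂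
  | app _ _ ih₁ ih₂ => exact ih₁.app ih₂
  | beta A _ _ ih₁ ih₂ =>
    exact (Reds.app (Reds.lam (.refl : Reds A A) ih₁) ih₂).tail (.beta _ _ _)

theorem Par.lift {t t' : Tm} (h : Par t t') (n : ℕ) :
    ∀ k, Par (lift n k t) (lift n k t') := by
  induction h with
  | var | sort => intro k; exact .refl _
  | pi _ _ ih₁ ih₂ => intro k; exact .pi (ih₁ k) (ih₂ (k + 1))
  | lam _ _ ih₁ ih₂ => intro k; exact .lam (ih₁ k) (ih₂ (k + 1))
  | app _ _ ih₁ ih₂ => intro k; exact .app (ih₁ k) (ih₂ k)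
  | @beta A t t' u u' _ _ ih₁ ih₂ =>
    intro k
    have e := lift_subst u' n k t' 0
    rw [Nat.add_zero] at e
    rw [e]
    exact .beta _ (ih₁ (k + 1)) (ih₂ k)

theorem Par.subst {t t' u u' : Tm} (h : Par t t') (hu : Par u u') :
    ∀ k, Par (subst u k t) (subst u' k t') := by
  induction h with
  | var i =>
    intro k
    simp only [CComega.subst]
    split_ifs
    · exact .refl _
    · exact hu.lift _ _
    · exact .refl _
  | sort => intro k; exact .refl _
  | pi _ _ ih₁ ih₂ => intro k; exact .pi (ih₁ k) (ih₂ (k + 1))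
  | lam _ _ ih₁ ih₂ => intro k; exact .lam (ih₁ k) (ih₂ (k + 1))
  | app _ _ ih₁ ih₂ => intro k; exact .app (ih₁ k) (ih₂ k)
  | @beta A t t' v v' _ _ ih₁ ih₂ =>
    intro k
    have e := subst_subst u' v' k t' 0
    rw [Nat.add_zero] at e
    rw [e]
    exact .beta _ (ih₁ (k + 1)) (ih₂ k)

/-- Complete development: contracts every redex of a term simultaneously. -/
def develop : Tm → Tm
  | .var i => .var i
  | .sort i => .sort i
  | .pi A B => .pi (develop A) (develop B)
  | .lam A t => .lam (develop A) (develop t)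
  | .app (.lam _ t) u => subst (develop u) 0 (develop t)
  | .app t u => .app (develop t) (develop u)

theorem Par.develop {t u : Tm} (h : Par t u) : Par u (develop t) := by
  induction h with
  | var i => exact .var i
  | sort i => exact .sort i
  | pi _ _ ih₁ ih₂ => exact .pi ih₁ ih₂
  | lam _ _ ih₁ ih₂ => exact .lam ih₁ ih₂
  | beta A _ _ ih₁ ih₂ => exact ih₁.subst ih₂ 0
  | app h₁ _ ih₁ ih₂ =>
    cases h₁ with
    | lam =>
      cases ih₁ with
      | lam _ ht => exact .beta _ ht ih₂
    | _ => exact .app ih₁ ih₂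

theorem reflTransGen_par_iff {t u : Tm} : Relation.ReflTransGen Par t u ↔ Reds t u := by
  constructor
  · intro h
    induction h with
    | refl => exact .refl
    | tail _ h ih => exact ih.trans h.reds
  · exact fun h => Relation.ReflTransGen.mono (fun _ _ => Red.par) _ _ h

theorem Reds.confluent {t u v : Tm} (hu : Reds t u) (hv : Reds t v) :
    ∃ w, Reds u w ∧ Reds v w := by
  obtain ⟨w, h₁, h₂⟩ := Relation.church_rosser
    (fun a _ _ hb hc => ⟨CComega.develop a, .single hb.develop, .single hc.develop⟩)
    (reflTransGen_par_iff.2 hu) (reflTransGen_par_iff.2 hv)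
  exact ⟨w, reflTransGen_par_iff.1 h₁, reflTransGen_par_iff.1 h₂⟩

theorem Conv.exists_reds {t u : Tm} (h : Conv t u) : ∃ w, Reds t w ∧ Reds u w := by
  induction h with
  | rel _ _ h => exact ⟨_, .single h, .refl⟩
  | refl => exact ⟨_, .refl, .refl⟩
  | symm _ _ _ ih => exact ih.imp fun _ => And.symm
  | trans _ _ _ _ _ ih₁ ih₂ =>
    obtain ⟨w₁, h₁, h₁'⟩ := ih₁
    obtain ⟨w₂, h₂, h₂'⟩ := ih₂
    obtain ⟨w, hw₁, hw₂⟩ := h₁'.confluent h₂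
    exact ⟨w, h₁.trans hw₁, h₂'.trans hw₂⟩

end Confluence

section Inversion

theorem Reds.conv {t u : Tm} (h : Reds t u) : Conv t u := by
  induction h with
  | refl => exact .refl _
  | tail _ h ih => exact ih.trans _ _ _ (.rel _ _ h)

theorem Reds.sort_inv {i : ℕ} {t : Tm} (h : Reds (.sort i) t) : t = .sort i := by
  induction h with
  | refl => rfl
  | tail _ h ih => subst ih; cases h

theorem Reds.pi_inv {A B t : Tm} (h : Reds (.pi A B) t) :
    ∃ A' B', t = .pi A' B' ∧ Reds A A' ∧ Reds B B' := by
  induction h with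
  | refl => exact ⟨A, B, rfl, .refl, .refl⟩
  | tail _ h ih =>
    obtain ⟨A', B', rfl, hA, hB⟩ := ih
    cases h with
    | piDom _ h => exact ⟨_, _, rfl, hA.tail h, hB⟩
    | piCod _ h => exact ⟨_, _, rfl, hA, hB.tail h⟩

theorem Cum.exists_reds_sort {t u : Tm} (h : Cum t u) :
    ∀ {i}, Reds u (.sort i) → ∃ j ≤ i, Reds t (.sort j) := by
  induction h with
  | ofConv h =>
    intro i hu
    obtain ⟨w, h₁, h₂⟩ := Conv.exists_reds (h.trans _ _ _ hu.conv)
    exact ⟨i, le_rfl, h₂.sort_inv ▸ h₁⟩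
  | sort hij =>
    intro k hu
    cases hu.sort_inv
    exact ⟨_, hij, .refl⟩
  | pi =>
    intro i hu
    obtain ⟨_, _, h, _⟩ := hu.pi_inv
    cases h
  | trans _ _ ih₁ ih₂ =>
    intro i hu
    obtain ⟨j, hj, h⟩ := ih₂ hu
    obtain ⟨k, hk, h'⟩ := ih₁ h
    exact ⟨k, hk.trans hj, h'⟩

theorem Cum.exists_reds_pi {t u : Tm} (h : Cum t u) :
    ∀ {A B}, Reds u (.pi A B) → ∃ A' B', Reds t (.pi A' B') ∧ Conv A' A ∧ Cum B' B := by
  induction h with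
  | ofConv h =>
    intro A B hu
    obtain ⟨w, h₁, h₂⟩ := Conv.exists_reds (h.trans _ _ _ hu.conv)
    obtain ⟨A', B', rfl, hA, hB⟩ := h₂.pi_inv
    exact ⟨A', B', h₁, hA.conv.symm, .ofConv hB.conv.symm⟩
  | sort =>
    intro A B hu
    cases hu.sort_inv
  | pi hA hB =>
    intro A B hu
    obtain ⟨_, _, h, hA', hB'⟩ := hu.pi_inv
    cases h
    exact ⟨_, _, .refl, hA.trans _ _ _ hA'.conv, hB.trans (.ofConv hB'.conv)⟩
  | trans _ _ ih₁ ih₂ =>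
    intro A B hu
    obtain ⟨A₂, B₂, h₂, hA₂, hB₂⟩ := ih₂ hu
    obtain ⟨A₁, B₁, h₁, hA₁, hB₁⟩ := ih₁ h₂
    exact ⟨A₁, B₁, h₁, hA₁.trans _ _ _ hA₂, hB₁.trans hB₂⟩

theorem Conv.subst {t t' : Tm} (h : Conv t t') (u : Tm) (k : ℕ) :
    Conv (subst u k t) (subst u k t') := by
  induction h with
  | rel _ _ h => exact (h.par.subst (.refl u) k).reds.conv
  | refl => exact .refl _
  | symm _ _ _ ih => exact ih.symm
  | trans _ _ _ _ _ ih₁ ih₂ => exact ih₁.trans _ _ _ ih₂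

theorem Cum.subst {t t' : Tm} (h : Cum t t') (u : Tm) :
    ∀ k, Cum (subst u k t) (subst u k t') := by
  induction h with
  | ofConv h => exact fun k => .ofConv (h.subst u k)
  | sort h => exact fun _ => .sort h
  | pi hA _ ih => exact fun k => .pi (hA.subst u k) (ih (k + 1))
  | trans _ _ ih₁ ih₂ => exact fun k => (ih₁ k).trans (ih₂ k)

theorem Cum.refl (t : Tm) : Cum t t := .ofConv (.refl t)

theorem InferC.exists_inferSortC {Γ : Ctx} {t T : Tm} {i : ℕ} (h : InferC Γ t T)
    (hT : Cum T (.sort i)) : ∃ j ≤ i, InferSortC Γ t (.sort j) :=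
  let ⟨j, hj, hr⟩ := hT.exists_reds_sort .refl
  ⟨j, hj, .inferSort h hr⟩

end Inversion

/-- **Completeness with cumulativity.** If `Γ ⊢ t : T` in the cumulative
undirected system, then `Γ ⊢ t ▹ T'` in the cumulative bidirectional system
for some `T' ≼ T`. -/
theorem completeness_cumul {Γ : Ctx} {t T : Tm} (h : TypedC Γ t T) :
    ∃ T', InferC Γ t T' ∧ Cum T' T := by
  refine TypedC.rec (motive_1 := fun _ _ => True)
    (motive_2 := fun Γ t T _ => ∃ T', InferC Γ t T' ∧ Cum T' T)
    trivial (fun _ _ _ _ => trivial) ?_ ?_ ?_ ?_ ?_ ?_ h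
  · exact fun _ _ => ⟨_, .sort, .refl _⟩
  · exact fun _ hn _ => ⟨_, .var hn, .refl _⟩
  · rintro Γ A B i j - - ⟨_, hA, hi⟩ ⟨_, hB, hj⟩
    obtain ⟨i', hi', hA⟩ := hA.exists_inferSortC hi
    obtain ⟨j', hj', hB⟩ := hB.exists_inferSortC hj
    exact ⟨_, .pi hA hB, .sort (max_le_max hi' hj')⟩
  · rintro Γ A B t i - - ⟨_, hP, -⟩ ⟨B', ht, hB⟩
    cases hP with
    | pi hA _ => exact ⟨_, .lam hA ht, .pi (.refl A) hB⟩
  · rintro Γ t u A B - - ⟨T', ht, hT⟩ ⟨A'', hu, hA⟩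
    obtain ⟨A', B', hr, hA', hB⟩ := hT.exists_reds_pi .refl
    exact ⟨_, .app (.inferPi ht hr) (.check hu (hA.trans (.ofConv hA'.symm))), hB.subst u 0⟩
  · rintro Γ t A B i - - hAB ⟨T', ht, hT⟩ -
    exact ⟨T', ht, hT.trans hAB⟩

end CComega
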